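/- arXiv:2205.00397 — 3 statements merged into one kernel-verified Lean document; each statement's English description precedes it below -/
import Mathlib

section
/- Let G be a graph whose vertex set consists of a path P of order p together with one additional vertex v not on P. If v has at least k ≥ 1 neighbors on P, then G contains a path with end v of order at least (p + k)/2 + 1. -/
/-- Let `G` be a graph consisting of a path `P` of order `p` together with one further
vertex `v ∉ V(P)`.  If `v` has at least `k ≥ 1` neighbours on `P`, then `G` contains a
path with end `v` of order at least `(p + k)/2 + 1`.
(The order of a path is its number of vertices, i.e. its length plus one.) -/
theorem path_plus_vertex
    {V : Type*} [Fintype V] (G : SimpleGraph V)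
    (p k : ℕ) (hk : 1 ≤ k)
    (x y v : V) (P : G.Walk x y) (hP : P.IsPath)
    (hp : P.length + 1 = p) (hv : v ∉ P.support)
    (hspan : ∀ u : V, u ∈ P.support ∨ u = v)
    (hnbr : k ≤ Nat.card {u : V | u ∈ P.support ∧ G.Adj v u}) :
    ∃ (w : V) (Q : G.Walk v w), Q.IsPath ∧
      ((p : ℝ) + k) / 2 + 1 ≤ (Q.length + 1 : ℝ) := by
  classical
  set S : Finset ℕ := (Finset.range (P.length + 1)).filter fun i => G.Adj v (P.getVert i)
    with hS
  have hcard : k ≤ S.card := by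
    have hsub : {u : V | u ∈ P.support ∧ G.Adj v u} ⊆ ↑(S.image P.getVert) := by
      rintro u ⟨hu, hadj⟩
      obtain ⟨n, rfl, hn⟩ := SimpleGraph.Walk.mem_support_iff_exists_getVert.mp hu
      simp only [Finset.coe_image, Set.mem_image, Finset.mem_coe, hS, Finset.mem_filter,
        Finset.mem_range]
      exact ⟨n, ⟨by omega, hadj⟩, rfl⟩
    have h := Set.ncard_le_ncard hsub (Finset.finite_toSet _)
    rw [Set.ncard_coe_finset] at h
    exact hnbr.trans (h.trans Finset.card_image_le)
  have hne : S.Nonempty := Finset.card_pos.mp (by omega)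
  set a := S.min' hne
  set b := S.max' hne
  have hab : k ≤ b + 1 - a := by
    have hsub : S ⊆ Finset.Icc a b := fun i hi =>
      Finset.mem_Icc.mpr ⟨S.min'_le i hi, S.le_max' i hi⟩
    simpa using hcard.trans (Finset.card_le_card hsub)
  obtain ⟨ha, hva⟩ := Finset.mem_filter.mp (S.min'_mem hne)
  obtain ⟨hb, hvb⟩ := Finset.mem_filter.mp (S.max'_mem hne)
  rw [Finset.mem_range] at ha hb
  by_cases hlong : p + k ≤ 2 * (P.length - a + 1)
  · refine ⟨y, .cons hva (P.drop a), (hP.drop a).cons fun h => hv ?_, ?_⟩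
    · exact (P.isSubwalk_drop a).support_subset h
    · rw [SimpleGraph.Walk.length_cons, SimpleGraph.Walk.drop_length]
      have : ((p + k : ℕ) : ℝ) ≤ ((2 * (P.length - a + 1) : ℕ) : ℝ) := Nat.cast_le.mpr hlong
      push_cast at this ⊢
      linarith
  · have hshort : p + k ≤ 2 * (b + 1) := by omega
    refine ⟨x, .cons hvb (P.take b).reverse, (hP.take b).reverse.cons fun h => hv ?_, ?_⟩
    · rw [SimpleGraph.Walk.support_reverse, List.mem_reverse] at h
      exact (P.isSubwalk_take b).support_subset h
    · rw [SimpleGraph.Walk.length_cons, SimpleGraph.Walk.length_reverse,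
        SimpleGraph.Walk.take_length, min_eq_left (by omega)]
      have : ((p + k : ℕ) : ℝ) ≤ ((2 * (b + 1) : ℕ) : ℝ) := Nat.cast_le.mpr hshort
      push_cast at this ⊢
      linarith
end

section
/- Let T be a tree of order m and S a subtree of T. Suppose a graph G contains a subtree S' isomorphic to S via an isomorphism φ from V(S) to V(S'), such that d_G(v) ≥ m − 1 for every vertex v of G outside V(S') and for every vertex v of S' satisfying d_S(φ⁻¹(v)) < d_T(φ⁻¹(v)). Then G contains a subtree T' isomorphic to T with S' ⊆ T'. -/
namespace SimpleGraph

/-- A connected spanning subgraph of an acyclic graph contains every edge. -/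
lemma IsAcyclic.adj_of_connected_spanning {V : Type*} {T : SimpleGraph V} (hT : T.IsAcyclic)
    {H : T.Subgraph} (hH : H.Connected) (hspan : H.IsSpanning) {u v : V} (huv : T.Adj u v) :
    H.Adj u v := by
  by_contra hn
  have hbridge : T.IsBridge s(u, v) := isAcyclic_iff_forall_adj_isBridge.mp hT huv
  let f : H.coe →g T.deleteEdges {s(u, v)} :=
    { toFun := Subtype.val
      map_rel' := fun {a b} hab => by
        have hab' : H.Adj a b := hab
        refine deleteEdges_adj.mpr ⟨hab'.adj_sub, fun he => hn ?_⟩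
        rw [← Subgraph.mem_edgeSet] at hab' ⊢
        rwa [Set.mem_singleton_iff.mp he] at hab' }
  exact isBridge_iff.mp hbridge ((hH.coe ⟨u, hspan u⟩ ⟨v, hspan v⟩).map f)

/-- `g` restricts to an injective homomorphism from `H` to `G` extending `f` on `S`. -/
structure IsPartialEmbedding {V W : Type*} {T : SimpleGraph V} (G : SimpleGraph W)
    (S : T.Subgraph) (f : S.verts → W) (H : T.Subgraph) (g : V → W) : Prop where
  injOn : Set.InjOn g H.verts
  adj : ∀ ⦃a b⦄, H.Adj a b → G.Adj (g a) (g b)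
  extends_map : ∀ s : S.verts, g s = f s

/-- A partial embedding extends along an edge leaving its domain when the image of the endpoint
in the domain has enough neighbors. -/
lemma IsPartialEmbedding.exists_extend {V W : Type*} [Fintype V] [Fintype W]
    {T : SimpleGraph V} {G : SimpleGraph W} {S H : T.Subgraph} {f : S.verts → W} {g : V → W}
    (hg : IsPartialEmbedding G S f H g) (hSH : S ≤ H) {a b : V} (hab : T.Adj a b)
    (ha : a ∈ H.verts) (hb : b ∉ H.verts)
    (hdeg : Fintype.card V - 1 ≤ Nat.card (G.neighborSet (g a))) :
    ∃ g', IsPartialEmbedding G S f (H ⊔ T.subgraphOfAdj hab) g' := by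
  classical
  obtain ⟨w, hw, hwn⟩ : ∃ w ∈ G.neighborSet (g a), w ∉ g '' H.verts := by
    by_contra! hall
    have hsub : G.neighborSet (g a) ⊆ g '' (H.verts \ {a}) := by
      intro w hw
      obtain ⟨x, hx, rfl⟩ := hall w hw
      refine ⟨x, ⟨hx, ?_⟩, rfl⟩
      rintro rfl
      exact G.loopless.irrefl _ hw
    have hle := (Set.ncard_le_ncard hsub).trans (Set.ncard_image_le (Set.toFinite _))
    have hlt : (insert b H.verts).ncard ≤ Fintype.card V := by
      rw [← Nat.card_eq_fintype_card]; exact Set.ncard_le_card _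
    rw [Set.ncard_insert_of_notMem hb] at hlt
    have hdiff := Set.ncard_sdiff_singleton_add_one ha
    rw [Nat.card_coe_set_eq] at hdeg
    omega
  have hne : ∀ {x}, x ∈ H.verts → x ≠ b := fun hx h => hb (h ▸ hx)
  have hupd : ∀ {x}, x ∈ H.verts → Function.update g b w x = g x :=
    fun hx => Function.update_of_ne (hne hx) _ _
  have hverts : (H ⊔ T.subgraphOfAdj hab).verts = insert b H.verts := by
    ext x
    simp only [Subgraph.verts_sup, subgraphOfAdj_verts, Set.mem_union, Set.mem_insert_iff,
      Set.mem_singleton_iff]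
    grind
  refine ⟨Function.update g b w, ?_, ?_, ?_⟩
  · rw [hverts, Set.injOn_insert hb]
    refine ⟨hg.injOn.congr fun x hx => (hupd hx).symm, ?_⟩
    rintro ⟨x, hx, he⟩
    rw [hupd hx, Function.update_self] at he
    exact hwn ⟨x, hx, he⟩
  · intro x y hxy
    rcases hxy with hxy | hxy
    · rw [hupd hxy.fst_mem, hupd hxy.snd_mem]
      exact hg.adj hxy
    · rw [subgraphOfAdj_adj, Sym2.eq_iff] at hxy
      rcases hxy with ⟨rfl, rfl⟩ | ⟨rfl, rfl⟩
      · rw [hupd ha, Function.update_self]; exact hw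
      · rw [hupd ha, Function.update_self]; exact hw.symm
  · intro s
    rw [hupd (hSH.1 s.2), hg.extends_map]

end SimpleGraph

/-- Let `T` be a tree of order `m` and `S` a subtree of `T`.  If a graph `G` contains a
subtree `S' ≅ S` (via an isomorphism `φ`) such that `d_G(v) ≥ m - 1` for every vertex
`v ∉ V(S')` and for every `v ∈ V(S')` with `d_S(φ⁻¹(v)) < d_T(φ⁻¹(v))`, then `G`
contains a subtree `T' ≅ T` with `S' ⊆ T'`. -/
theorem tree_extension
    {V W : Type*} [Fintype V] [Fintype W]
    (T : SimpleGraph V) (hT : T.IsTree)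
    (S : T.Subgraph) (hS : S.coe.IsTree)
    (G : SimpleGraph W) (S' : G.Subgraph) (hS' : S'.coe.IsTree)
    (φ : S.coe ≃g S'.coe)
    (hout : ∀ w : W, w ∉ S'.verts → Fintype.card V - 1 ≤ Nat.card ↥(G.neighborSet w))
    (hin : ∀ v : S'.verts,
      Nat.card ↥(S.neighborSet ↑(φ.symm v)) < Nat.card ↥(T.neighborSet ↑(φ.symm v)) →
      Fintype.card V - 1 ≤ Nat.card ↥(G.neighborSet ↑v)) :
    ∃ T' : G.Subgraph, Nonempty (T'.coe ≃g T) ∧ S' ≤ T' := by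
  let f : S.verts → W := fun s => φ s
  have hf : Function.Injective f := Subtype.val_injective.comp φ.injective
  let P : T.Subgraph → Prop := fun H =>
    S ≤ H ∧ H.Connected ∧ ∃ g, SimpleGraph.IsPartialEmbedding G S f H g
  have hbase : P S := by
    obtain ⟨s₀⟩ := hS.1.nonempty
    have hext : ∀ s : S.verts, Function.extend Subtype.val f (fun _ => f s₀) s = f s :=
      Subtype.val_injective.extend_apply f _
    refine ⟨le_rfl, ⟨hS.1⟩, _, ?_, ?_, hext⟩
    · intro x hx y hy hxy
      rw [hext ⟨x, hx⟩, hext ⟨y, hy⟩] at hxy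
      exact congrArg Subtype.val (hf hxy)
    · intro x y hxy
      rw [hext ⟨x, hxy.fst_mem⟩, hext ⟨y, hxy.snd_mem⟩]
      exact (φ.map_rel_iff.mpr (show S.coe.Adj ⟨x, hxy.fst_mem⟩ ⟨y, hxy.snd_mem⟩ from hxy)).adj_sub
  obtain ⟨H, -, hH⟩ := exists_maximal_ge_of_wellFoundedGT P S hbase
  obtain ⟨⟨hSH, hconn, g, hg⟩, hmax⟩ := hH
  have hspan : H.IsSpanning := by
    by_contra hns
    obtain ⟨v, hv⟩ : ∃ v, v ∉ H.verts := by simpa [SimpleGraph.Subgraph.IsSpanning] using hns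
    obtain ⟨u, hu⟩ := hconn.nonempty
    obtain ⟨p⟩ := hT.1 u v
    obtain ⟨⟨⟨a, b⟩, hab⟩, -, ha, hb⟩ := p.exists_boundary_dart H.verts hu hv
    dsimp only at ha hb hab
    have hdeg : Fintype.card V - 1 ≤ Nat.card (G.neighborSet (g a)) := by
      by_cases hga : g a ∈ S'.verts
      · have hfa : f (φ.symm ⟨g a, hga⟩) = g a := by simp [f]
        have hsa : (φ.symm ⟨g a, hga⟩ : V) = a :=
          hg.injOn (hSH.1 (φ.symm ⟨g a, hga⟩).2) ha ((hg.extends_map _).trans hfa)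
        refine hin ⟨g a, hga⟩ ?_
        rw [hsa, Nat.card_coe_set_eq, Nat.card_coe_set_eq]
        refine Set.ncard_lt_ncard ⟨S.neighborSet_subset a, fun hsub => hb (hSH.1 ?_)⟩
        exact (hsub hab : S.Adj a b).snd_mem
      · exact hout _ hga
    have hle : H ⊔ T.subgraphOfAdj hab ≤ H :=
      hmax ⟨hSH.trans le_sup_left,
        SimpleGraph.Subgraph.connected_sup hconn.preconnected
          (SimpleGraph.Subgraph.subgraphOfAdj_connected hab).preconnected ⟨a, ha, by simp⟩,
        hg.exists_extend hSH hab ha hb hdeg⟩ le_sup_left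
    exact hb (hle.1 (by simp))
  let c : T.Copy G := ⟨⟨g, fun h => hg.adj (hT.2.adj_of_connected_spanning hconn hspan h)⟩,
    fun x y hxy => hg.injOn (hspan x) (hspan y) hxy⟩
  have hc : ∀ s : S'.verts, g (φ.symm s) = s := fun s => by
    rw [hg.extends_map]; simp [f]
  refine ⟨c.toSubgraph, ⟨c.isoToSubgraph.symm⟩, fun w hw => ?_, fun x y hxy => ?_⟩
  · exact ⟨φ.symm ⟨w, hw⟩, trivial, hc ⟨w, hw⟩⟩
  · have h : S.coe.Adj (φ.symm ⟨x, hxy.fst_mem⟩) (φ.symm ⟨y, hxy.snd_mem⟩) :=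
      φ.symm.map_rel_iff.mpr hxy
    exact ⟨_, _, h.adj_sub, hc ⟨x, hxy.fst_mem⟩, hc ⟨y, hxy.snd_mem⟩⟩
end

section
/- Let k be a positive integer and T a tree with bipartition X and Y, with t = max{|X|, |Y|}. The complete bipartite graph G = K_{k+t−1, k+t−1} contains no subtree T' isomorphic to T such that G − V(T') is k-connected. -/
/-- `G` is `k`-connected: every vertex set `S` whose removal leaves a disconnected graph
or a graph with exactly one vertex satisfies `|S| ≥ k` (i.e. `κ(G) ≥ k`). -/
def SimpleGraph.IsKConnected {V : Type*} (k : ℕ) (G : SimpleGraph V) : Prop :=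
  ∀ S : Set V, (¬ (G.induce Sᶜ).Connected ∨ Nat.card ↥(Sᶜ) = 1) → k ≤ Nat.card ↥S

/-- `X`, `Y` form a bipartition of the graph `G`. -/
def SimpleGraph.HasBipartition {V : Type*} (G : SimpleGraph V) (X Y : Set V) : Prop :=
  X ∪ Y = Set.univ ∧ Disjoint X Y ∧
    ∀ ⦃u v : V⦄, G.Adj u v → (u ∈ X ∧ v ∈ Y) ∨ (u ∈ Y ∧ v ∈ X)

/-- A homomorphism from a connected bipartitioned graph to a complete bipartite graph sends the
parts of the bipartition to opposite sides. -/
lemma SimpleGraph.HasBipartition.exists_forall_isLeft_eq_iff {V α β : Type*} {T : SimpleGraph V}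
    {X Y : Set V} (hT : T.Connected) (h : T.HasBipartition X Y)
    (f : T →g completeBipartiteGraph α β) :
    ∃ s : Bool, ∀ v, (f v).isLeft = s ↔ v ∈ X := by
  classical
  obtain ⟨-, hD, hA⟩ := h
  obtain ⟨v₀⟩ := hT.nonempty
  refine ⟨((f v₀).isLeft == decide (v₀ ∈ X)), fun v => ?_⟩
  obtain ⟨w⟩ := hT.preconnected v v₀
  induction w with
  | @nil u => by_cases hx : u ∈ X <;> cases f u <;> simp [hx]
  | @cons a b c hab _ ih =>
    have h1 := f.map_adj hab
    have h2 : a ∈ X ↔ b ∉ X := by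
      rcases hA hab with ⟨ha, hb⟩ | ⟨ha, hb⟩
      · simp [ha, hD.notMem_of_mem_right hb]
      · simp [hb, hD.notMem_of_mem_right ha]
    have h3 : (f a).isLeft = !(f b).isLeft := by
      cases ha : f a <;> cases hb : f b <;> simp_all [completeBipartiteGraph]
    rw [h2, ← ih, h3]
    cases (f b).isLeft <;> cases ((f c).isLeft == decide (c ∈ X)) <;> simp

lemma Set.ncard_setOf_isLeft_eq (n : ℕ) (s : Bool) :
    {y : Fin n ⊕ Fin n | y.isLeft = s}.ncard = n := by
  cases s
  · have : {y : Fin n ⊕ Fin n | y.isLeft = false} = Set.range Sum.inr := by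
      ext (y | y) <;> simp
    rw [this, ← Set.image_univ, Set.ncard_image_of_injective _ Sum.inr_injective]
    simp [Set.ncard_univ]
  · have : {y : Fin n ⊕ Fin n | y.isLeft = true} = Set.range Sum.inl := by
      ext (y | y) <;> simp
    rw [this, ← Set.image_univ, Set.ncard_image_of_injective _ Sum.inl_injective]
    simp [Set.ncard_univ]

/-- An edgeless graph is disconnected (possibly because it is empty) or has one vertex. -/
lemma SimpleGraph.not_connected_or_card_eq_one_of_forall_not_adj {V : Type*} {G : SimpleGraph V}
    (h : ∀ u v, ¬ G.Adj u v) : ¬ G.Connected ∨ Nat.card V = 1 := by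
  refine or_iff_not_imp_left.mpr fun hG => ?_
  rw [not_not] at hG
  have := hG.nonempty
  refine Nat.card_eq_one_iff_unique.mpr ⟨⟨fun u v => ?_⟩, this⟩
  obtain ⟨w⟩ := hG.preconnected u v
  cases w with
  | nil => rfl
  | cons hadj _ => exact absurd hadj (h _ _)

/-- If an embedded graph leaves a `k`-connected remainder of `K_{n,n}`, then at least `k` vertices
remain on each side. -/
lemma SimpleGraph.IsKConnected.add_ncard_le {V : Type*} {k n : ℕ}
    {f : V → Fin n ⊕ Fin n} (hf : Function.Injective f)
    (h : ((completeBipartiteGraph (Fin n) (Fin n)).induce (Set.range f)ᶜ).IsKConnected k)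
    (s : Bool) : k + {v | (f v).isLeft = s}.ncard ≤ n := by
  let S : Set ↥((Set.range f)ᶜ) := {x | x.1.isLeft = s}
  have hS := h S <| not_connected_or_card_eq_one_of_forall_not_adj fun u v huv => by
    have hu : u.1.1.isLeft ≠ s := u.2
    have hv : v.1.1.isLeft ≠ s := v.2
    have huv' : (completeBipartiteGraph (Fin n) (Fin n)).Adj u.1.1 v.1.1 := huv
    cases hu' : u.1.1 <;> cases hv' : v.1.1 <;> cases s <;> simp_all [completeBipartiteGraph]
  rw [Nat.card_coe_set_eq, ← Set.ncard_image_of_injective S Subtype.val_injective] at hS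
  rw [← Set.ncard_image_of_injective _ hf]
  have hdisj : Disjoint (Subtype.val '' S) (f '' {v | (f v).isLeft = s}) := by
    rw [Set.disjoint_left]
    rintro _ ⟨x, -, rfl⟩ ⟨v, -, hv⟩
    exact x.2 ⟨v, hv⟩
  have hsub : Subtype.val '' S ∪ f '' {v | (f v).isLeft = s} ⊆ {y | y.isLeft = s} := by
    rintro _ (⟨x, hx, rfl⟩ | ⟨v, hv, rfl⟩)
    exacts [hx, hv]
  have := Set.ncard_le_ncard hsub
  rw [Set.ncard_union_eq hdisj, Set.ncard_setOf_isLeft_eq] at this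
  omega

/-- Let `k ≥ 1` and let `T` be a tree with bipartition `X`, `Y`, `t = max{|X|,|Y|}`.
The complete bipartite graph `K_{k+t-1, k+t-1}` contains no subtree `T' ≅ T` (image of
an injective homomorphism of `T`) whose deletion leaves a `k`-connected graph. -/
theorem complete_bipartite_no_tree_deletion
    {V : Type*} [Fintype V] (k : ℕ) (hk : 0 < k)
    (T : SimpleGraph V) (hT : T.IsTree)
    (X Y : Set V) (hTbip : T.HasBipartition X Y)
    (n : ℕ) (hn : n = k + max (Nat.card ↥X) (Nat.card ↥Y) - 1) :
    ¬ ∃ f : T →g completeBipartiteGraph (Fin n) (Fin n),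
        Function.Injective f ∧
        ((completeBipartiteGraph (Fin n) (Fin n)).induce
          (Set.range ⇑f)ᶜ).IsKConnected k := by
  rintro ⟨f, hf, h⟩
  obtain ⟨s, hs⟩ := hTbip.exists_forall_isLeft_eq_iff hT.connected f
  have hX : {v | (f v).isLeft = s} = X := Set.ext hs
  have hY : {v | (f v).isLeft = !s} = Y := by
    have hXY : IsCompl X Y := ⟨hTbip.2.1, codisjoint_iff.mpr hTbip.1⟩
    rw [← hXY.compl_eq, ← hX]
    ext v
    simp [Bool.eq_not]
  have h₁ := h.add_ncard_le hf s
  have h₂ := h.add_ncard_le hf (!s)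
  rw [hX] at h₁
  rw [hY] at h₂
  rw [Nat.card_coe_set_eq, Nat.card_coe_set_eq] at hn
  omega
end
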